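/- arXiv:2104.06369 — 2 statements merged into one kernel-verified Lean document; each statement's English description precedes it below -/
import Mathlib

section
/- Let G be a separable Gurariy space and let X be a (possibly non-separable) real Banach space. Then X is a Gurariy space if and only if every separable almost isometric ideal in X is almost isometric to G. -/
open TopologicalSpace

/-- `T` is an `ε`-isometry: `(1+ε)⁻¹‖x‖ ≤ ‖T x‖ ≤ (1+ε)‖x‖` for all `x`. -/
def IsEpsIsometry {X Y : Type*} [NormedAddCommGroup X] [NormedAddCommGroup Y]
    (ε : ℝ) (T : X → Y) : Prop :=
  ∀ x : X, (1 + ε)⁻¹ * ‖x‖ ≤ ‖T x‖ ∧ ‖T x‖ ≤ (1 + ε) * ‖x‖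

/-- `X` and `Y` are almost isometric: for every `ε > 0` there is a surjective linear
`ε`-isometry from `X` onto `Y`. -/
def AlmostIsometric (X Y : Type*) [NormedAddCommGroup X] [NormedSpace ℝ X]
    [NormedAddCommGroup Y] [NormedSpace ℝ Y] : Prop :=
  ∀ ε : ℝ, 0 < ε → ∃ T : X →ₗ[ℝ] Y, Function.Surjective T ∧ IsEpsIsometry ε ⇑T

/-- `X` is a Gurariy space: for every `ε > 0`, every pair of finite-dimensional normed
spaces `E ⊆ F` and every linear isometric embedding `T : E → X`, there is a linear
extension `S : F → X` of `T` which is an `ε`-isometry. -/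
def IsGurariy (X : Type*) [NormedAddCommGroup X] [NormedSpace ℝ X] : Prop :=
  ∀ ε : ℝ, 0 < ε →
    ∀ (F : Type) [NormedAddCommGroup F] [NormedSpace ℝ F] [FiniteDimensional ℝ F]
      (E : Subspace ℝ F) (T : E →ₗ[ℝ] X),
      (∀ e : E, ‖T e‖ = ‖e‖) →
      ∃ S : F →ₗ[ℝ] X, (∀ e : E, S e = T e) ∧ IsEpsIsometry ε ⇑S

/-- `Y` is an almost isometric ideal (a.i.-ideal) in `X`. -/
def IsAIIdeal {X : Type*} [NormedAddCommGroup X] [NormedSpace ℝ X]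
    (Y : Subspace ℝ X) : Prop :=
  IsClosed (Y : Set X) ∧
  ∀ ε : ℝ, 0 < ε → ∀ E : Subspace ℝ X, FiniteDimensional ℝ E →
    ∃ T : E →ₗ[ℝ] Y, (∀ e : E, (e : X) ∈ Y → ((T e : Y) : X) = (e : X)) ∧
      IsEpsIsometry ε ⇑T


lemma gur1 {Y : Type*} [NormedAddCommGroup Y] [NormedSpace ℝ Y] (hY : IsGurariy Y) {δ : ℝ}
    (hδ : 0 < δ) {F : Type} [AddCommGroup F] [Module ℝ F] [FiniteDimensional ℝ F]
    (p : Seminorm ℝ F) (hp : ∀ x, p x = 0 → x = 0) (E : Submodule ℝ F) (T : E →ₗ[ℝ] Y)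
    (hT : ∀ e : E, ‖T e‖ = p e) :
    ∃ S : F →ₗ[ℝ] Y, (∀ e : E, S e = T e) ∧
      ∀ f, (1 + δ)⁻¹ * p f ≤ ‖S f‖ ∧ ‖S f‖ ≤ (1 + δ) * p f := by
  let n : NormedAddCommGroup F := AddGroupNorm.toNormedAddCommGroup
    { toFun := p
      map_zero' := map_zero p
      add_le' := map_add_le_add p
      neg' := map_neg_eq_map p
      eq_zero_of_map_eq_zero' := hp }
  let : NormedSpace ℝ F := { norm_smul_le := fun a b => (map_smul_eq_mul p a b).le }
  exact hY δ hδ F E T hT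

lemma gur2 {Y : Type*} [NormedAddCommGroup Y] [NormedSpace ℝ Y] (hY : IsGurariy Y) {δ : ℝ}
    (hδ : 0 < δ) {F : Type*} [AddCommGroup F] [Module ℝ F] [FiniteDimensional ℝ F]
    (p : Seminorm ℝ F) (hp : ∀ x, p x = 0 → x = 0) (E : Submodule ℝ F) (T : E →ₗ[ℝ] Y)
    (hT : ∀ e : E, ‖T e‖ = p e) :
    ∃ S : F →ₗ[ℝ] Y, (∀ e : E, S e = T e) ∧
      ∀ f, (1 + δ)⁻¹ * p f ≤ ‖S f‖ ∧ ‖S f‖ ≤ (1 + δ) * p f := by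
  let u : F ≃ₗ[ℝ] (Fin (Module.finrank ℝ F) → ℝ) := (Module.finBasis ℝ F).equivFun
  let v : E.comap u.symm.toLinearMap →ₗ[ℝ] E :=
    (u.symm.toLinearMap.restrict (p := E.comap u.symm.toLinearMap) (q := E) (fun x hx => hx))
  obtain ⟨S, h1, h2⟩ := gur1 hY hδ (p.comp u.symm.toLinearMap)
    (fun x hx => by simpa using hp _ hx) (E.comap u.symm.toLinearMap) (T ∘ₗ v)
    (fun e => hT (v e))
  refine ⟨S ∘ₗ u.toLinearMap, fun e => ?_, fun f => ?_⟩
  · have := h1 ⟨u e, by simp⟩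
    simp only [LinearMap.comp_apply, LinearEquiv.coe_coe] at this ⊢
    rw [this]
    congr 1
    ext
    simp [v]
  · simpa using h2 (u f)

lemma gur3 {Y : Type*} [NormedAddCommGroup Y] [NormedSpace ℝ Y] (hY : IsGurariy Y)
    {F : Type*} [AddCommGroup F] [Module ℝ F] [FiniteDimensional ℝ F]
    (q : Seminorm ℝ F) (hq : ∀ x, q x = 0 → x = 0) (E : Submodule ℝ F) (T : E →ₗ[ℝ] Y)
    {C C' : ℝ} (hC : 1 ≤ C) (hCC : C < C')
    (hT : ∀ e : E, ‖T e‖ ≤ C * q e ∧ q e ≤ C * ‖T e‖) :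
    ∃ S : F →ₗ[ℝ] Y, (∀ e : E, S e = T e) ∧
      ∀ f, ‖S f‖ ≤ C' * q f ∧ q f ≤ C' * ‖S f‖ := by
  have hC0 : 0 < C := by linarith
  have hnn : ∀ f (e : E), 0 ≤ ‖T e‖ + C * q (f - e) := fun f e => by positivity
  have hbdd : ∀ f, BddBelow (Set.range fun e : E => ‖T e‖ + C * q (f - e)) := fun f =>
    ⟨0, by rintro _ ⟨e, rfl⟩; exact hnn f e⟩
  let p : Seminorm ℝ F := Seminorm.ofSMulLE (fun f => ⨅ e : E, ‖T e‖ + C * q (f - e))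
    (by
      apply le_antisymm
      · refine (ciInf_le (hbdd 0) 0).trans (by simp)
      · exact Real.iInf_nonneg (hnn 0))
    (by
      intro f g
      refine le_ciInf_add_ciInf fun d e => ?_
      refine (ciInf_le (hbdd _) (d + e)).trans ?_
      have h1 : ‖T (d + e)‖ ≤ ‖T d‖ + ‖T e‖ := by rw [map_add]; exact norm_add_le _ _
      have h2 : q (f + g - ((d + e : E) : F)) ≤ q (f - d) + q (g - e) := by
        have : f + g - ((d + e : E) : F) = (f - d) + (g - e) := by push_cast; abel
        rw [this]; exact map_add_le_add q _ _
      nlinarith)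
    (by
      intro r f
      rw [Real.mul_iInf_of_nonneg (norm_nonneg r)]
      refine le_ciInf fun e => ?_
      refine (ciInf_le (hbdd _) (r • e)).trans (le_of_eq ?_)
      have : r • f - ((r • e : E) : F) = r • (f - e) := by push_cast; rw [smul_sub]
      rw [this, map_smul, norm_smul, map_smul_eq_mul]; ring)
  have hpdef : ∀ f, p f = ⨅ e : E, ‖T e‖ + C * q (f - e) := fun f => rfl
  have hp1 : ∀ f, p f ≤ C * q f := fun f => by
    rw [hpdef]; exact (ciInf_le (hbdd f) 0).trans (by simp)
  have hp2 : ∀ f, q f ≤ C * p f := fun f => by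
    rw [hpdef, Real.mul_iInf_of_nonneg hC0.le]
    refine le_ciInf fun e => ?_
    have h1 : q f ≤ q e + q (f - e) := by
      have := map_add_le_add q (e : F) (f - e)
      rwa [add_sub_cancel] at this
    have h2 := (hT e).2
    have h3 : 0 ≤ q (f - e) := apply_nonneg q _
    nlinarith [mul_nonneg (mul_nonneg (by linarith : 0 ≤ C - 1) (by linarith : 0 ≤ C + 1)) h3]
  have hp3 : ∀ e : E, ‖T e‖ = p e := fun e => by
    apply le_antisymm
    · rw [hpdef]
      refine le_ciInf fun d => ?_
      have h1 := (hT (e - d)).1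
      have h2 : ‖T e‖ ≤ ‖T d‖ + ‖T (e - d)‖ := by
        rw [map_sub]; exact norm_le_insert' _ _
      push_cast at h1
      linarith
    · rw [hpdef]; exact (ciInf_le (hbdd _) e).trans (by simp)
  have hδ : 0 < C' / C - 1 := by
    rw [sub_pos, lt_div_iff₀ hC0]; linarith
  obtain ⟨S, hS1, hS2⟩ := gur2 hY hδ p
    (fun x hx => hq x (le_antisymm ((hp2 x).trans (by simp [hx])) (apply_nonneg q _))) E T hp3
  refine ⟨S, hS1, fun f => ?_⟩
  obtain ⟨h1, h2⟩ := hS2 f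
  rw [add_sub_cancel] at h1 h2
  have hC' : 0 < C' := by linarith
  constructor
  · calc ‖S f‖ ≤ C' / C * p f := h2
      _ ≤ C' / C * (C * q f) := by gcongr; exact hp1 f
      _ = C' * q f := by field_simp
  · calc q f ≤ C * p f := hp2 f
      _ = C' * ((C' / C)⁻¹ * p f) := by field_simp
      _ ≤ C' * ‖S f‖ := by gcongr

def GoodRel {X Y : Type*} [NormedAddCommGroup X] [NormedSpace ℝ X]
    [NormedAddCommGroup Y] [NormedSpace ℝ Y] (C : ℝ) (Γ : Submodule ℝ (X × Y)) : Prop :=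
  FiniteDimensional ℝ Γ ∧ ∀ z ∈ Γ, ‖z.1‖ ≤ C * ‖z.2‖ ∧ ‖z.2‖ ≤ C * ‖z.1‖

lemma good_step {X Y : Type*} [NormedAddCommGroup X] [NormedSpace ℝ X]
    [NormedAddCommGroup Y] [NormedSpace ℝ Y] (hY : IsGurariy Y) {C C' : ℝ} (hC : 1 ≤ C)
    (hCC : C < C') (Γ : Submodule ℝ (X × Y)) (hΓ : GoodRel C Γ) (x : X) :
    ∃ Γ' : Submodule ℝ (X × Y), GoodRel C' Γ' ∧ Γ ≤ Γ' ∧ ∃ y, (x, y) ∈ Γ' := by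
  obtain ⟨hfd, hb⟩ := hΓ
  by_cases hx : ∃ y, (x, y) ∈ Γ
  · refine ⟨Γ, ⟨hfd, fun z hz => ?_⟩, le_rfl, hx⟩
    obtain ⟨h1, h2⟩ := hb z hz
    exact ⟨h1.trans (by gcongr), h2.trans (by gcongr)⟩
  let i : (Γ × ℝ) →ₗ[ℝ] X :=
    (LinearMap.fst ℝ X Y ∘ₗ Γ.subtype).coprod (LinearMap.toSpanSingleton ℝ X x)
  have hi : ∀ z : Γ × ℝ, i z = z.1.1.1 + z.2 • x := fun z => by simp [i]
  have hinj : ∀ z, i z = 0 → z = 0 := by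
    rintro ⟨⟨z, hz⟩, t⟩ h
    rw [hi] at h
    simp only at h
    have ht : t = 0 := by
      by_contra ht
      apply hx
      refine ⟨(-t⁻¹ • z).2, ?_⟩
      have : x = (-t⁻¹ • z).1 := by
        have h' : z.1 = - (t • x) := eq_neg_of_add_eq_zero_left h
        simp [h', smul_smul, ht]
      have h3 := Γ.smul_mem (-t⁻¹) hz
      rwa [this]
    subst ht
    have h1 : z.1 = 0 := by simpa using h
    have h2 := (hb z hz).2
    rw [h1] at h2
    have h3 : z.2 = 0 := by simpa using h2
    have : z = 0 := Prod.ext h1 h3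
    subst this
    rfl
  let E : Submodule ℝ (Γ × ℝ) := Submodule.prod ⊤ ⊥
  let T : E →ₗ[ℝ] Y := LinearMap.snd ℝ X Y ∘ₗ Γ.subtype ∘ₗ LinearMap.fst ℝ Γ ℝ ∘ₗ E.subtype
  obtain ⟨S, hS1, hS2⟩ := gur3 hY ((normSeminorm ℝ X).comp i)
    (fun z hz => hinj z (by simpa using hz)) E T hC hCC (by
      rintro ⟨⟨z, t⟩, hz⟩
      have ht : t = 0 := by simpa [E] using hz
      subst ht
      have := hb z z.2
      simpa [T, hi] using this.symm)
  refine ⟨LinearMap.range (i.prod S), ⟨inferInstance, ?_⟩, ?_, ?_⟩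
  · rintro _ ⟨f, rfl⟩
    simpa using (hS2 f).symm
  · intro z hz
    refine ⟨(⟨z, hz⟩, 0), ?_⟩
    have := hS1 ⟨(⟨z, hz⟩, 0), by simp [E]⟩
    simp only [LinearMap.prod_apply, Function.prod, hi]
    exact Prod.ext (by simp) this
  · exact ⟨S (0, 1), (0, 1), Prod.ext (by simp [hi]) rfl⟩

lemma good_step' {X Y : Type*} [NormedAddCommGroup X] [NormedSpace ℝ X]
    [NormedAddCommGroup Y] [NormedSpace ℝ Y] (hX : IsGurariy X) {C C' : ℝ} (hC : 1 ≤ C)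
    (hCC : C < C') (Γ : Submodule ℝ (X × Y)) (hΓ : GoodRel C Γ) (y : Y) :
    ∃ Γ' : Submodule ℝ (X × Y), GoodRel C' Γ' ∧ Γ ≤ Γ' ∧ ∃ x, (x, y) ∈ Γ' := by
  obtain ⟨hfd, hb⟩ := hΓ
  obtain ⟨Γ', ⟨h1, h1'⟩, h2, x, h3⟩ := good_step hX hC hCC
    (Γ.map (LinearEquiv.prodComm ℝ X Y).toLinearMap) ⟨inferInstance, by
      rintro _ ⟨z, hz, rfl⟩
      exact (hb z hz).symm⟩ y
  refine ⟨Γ'.map (LinearEquiv.prodComm ℝ Y X).toLinearMap, ⟨inferInstance, ?_⟩, ?_,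
    x, ⟨(y, x), h3, rfl⟩⟩
  · rintro _ ⟨z, hz, rfl⟩
    exact (h1' z hz).symm
  · intro z hz
    exact ⟨(z.2, z.1), h2 ⟨z, hz, rfl⟩, rfl⟩

lemma rel_to_map {X Y : Type*} [NormedAddCommGroup X] [NormedSpace ℝ X] [CompleteSpace X]
    [NormedAddCommGroup Y] [NormedSpace ℝ Y] [CompleteSpace Y] {C : ℝ} (hC : 1 ≤ C)
    (Γ : Submodule ℝ (X × Y)) (hc : IsClosed (Γ : Set (X × Y)))
    (hb : ∀ z ∈ Γ, ‖z.1‖ ≤ C * ‖z.2‖ ∧ ‖z.2‖ ≤ C * ‖z.1‖)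
    (h1 : Dense (Prod.fst '' (Γ : Set (X × Y)))) (h2 : Dense (Prod.snd '' (Γ : Set (X × Y)))) :
    ∃ T : X →ₗ[ℝ] Y, Function.Surjective T ∧ ∀ x, ‖x‖ ≤ C * ‖T x‖ ∧ ‖T x‖ ≤ C * ‖x‖ := by
  have : CompleteSpace Γ := hc.completeSpace_coe
  let P : Γ →L[ℝ] X := ContinuousLinearMap.fst ℝ X Y ∘L Γ.subtypeL
  let Q : Γ →L[ℝ] Y := ContinuousLinearMap.snd ℝ X Y ∘L Γ.subtypeL
  have hP : AntilipschitzWith ⟨C, by linarith⟩ P :=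
    AddMonoidHomClass.antilipschitz_of_bound P fun z => by
      have h := (hb z z.2).2
      have h' : ‖(z : X × Y).1‖ ≤ C * ‖(z : X × Y).1‖ := le_mul_of_one_le_left (norm_nonneg _) hC
      exact max_le h' h
  have hQ : AntilipschitzWith ⟨C, by linarith⟩ Q :=
    AddMonoidHomClass.antilipschitz_of_bound Q fun z => by
      have h := (hb z z.2).1
      have h' : ‖(z : X × Y).2‖ ≤ C * ‖(z : X × Y).2‖ := le_mul_of_one_le_left (norm_nonneg _) hC
      exact max_le h h'
  have hPs : Function.Surjective P := by
    rw [← Set.range_eq_univ, ← (hP.isClosed_range P.uniformContinuous).closure_eq]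
    convert h1.closure_eq using 2
    ext; simp [P]
  have hQs : Function.Surjective Q := by
    rw [← Set.range_eq_univ, ← (hQ.isClosed_range Q.uniformContinuous).closure_eq]
    convert h2.closure_eq using 2
    ext; simp [Q]
  let e : Γ ≃ₗ[ℝ] X := LinearEquiv.ofBijective P.toLinearMap ⟨hP.injective, hPs⟩
  refine ⟨Q.toLinearMap ∘ₗ e.symm.toLinearMap, hQs.comp e.symm.surjective, fun x => ?_⟩
  obtain ⟨z, rfl⟩ := e.surjective x
  have h1 : (Q.toLinearMap ∘ₗ e.symm.toLinearMap) (e z) = (z : X × Y).2 := by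
    simp only [LinearMap.comp_apply, LinearEquiv.coe_coe, LinearEquiv.symm_apply_apply]
    rfl
  rw [h1]
  exact hb z z.2

lemma gur_unique {X Y : Type*} [NormedAddCommGroup X] [NormedSpace ℝ X] [CompleteSpace X]
    [SeparableSpace X]
    [NormedAddCommGroup Y] [NormedSpace ℝ Y] [CompleteSpace Y] [SeparableSpace Y]
    (hX : IsGurariy X) (hY : IsGurariy Y) : AlmostIsometric X Y := by
  intro ε hε
  let c : ℕ → ℝ := fun n => 1 + ε - ε * (1 / 2) ^ n
  have hc1 : ∀ n, 1 ≤ c n := fun n => by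
    have : ((1:ℝ) / 2) ^ n ≤ 1 := pow_le_one₀ (by norm_num) (by norm_num)
    simp only [c]; nlinarith
  have hc2 : ∀ n, c n < c (n + 1) := fun n => by
    have : (0:ℝ) < (1 / 2) ^ n := by positivity
    simp only [c, pow_succ]; nlinarith
  have hc3 : ∀ n, c n ≤ 1 + ε := fun n => by
    have : (0:ℝ) < (1 / 2) ^ n := by positivity
    simp only [c]; nlinarith
  have step : ∀ n (Γ : {Γ : Submodule ℝ (X × Y) // GoodRel (c n) Γ}),
      ∃ Γ' : {Γ : Submodule ℝ (X × Y) // GoodRel (c (n + 1)) Γ}, Γ.1 ≤ Γ'.1 ∧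
        (∃ y, (denseSeq X n, y) ∈ Γ'.1) ∧ ∃ x, (x, denseSeq Y n) ∈ Γ'.1 := by
    rintro n ⟨Γ, hΓ⟩
    obtain ⟨m, hm1, hm2⟩ := exists_between (hc2 n)
    obtain ⟨Γ₁, h1, h2, y, h3⟩ := good_step hY (hc1 n) hm1 Γ hΓ (denseSeq X n)
    obtain ⟨Γ₂, h4, h5, x, h6⟩ := good_step' hX ((hc1 n).trans hm1.le) hm2 Γ₁ h1 (denseSeq Y n)
    exact ⟨⟨Γ₂, h4⟩, h2.trans h5, ⟨y, h5 h3⟩, x, h6⟩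
  choose g hg1 hg2 hg3 using step
  let base : {Γ : Submodule ℝ (X × Y) // GoodRel (c 0) Γ} := ⟨⊥, inferInstance, by
    intro z hz
    have : z = 0 := by simpa using hz
    subst this; simp⟩
  let f : ∀ n, {Γ : Submodule ℝ (X × Y) // GoodRel (c n) Γ} :=
    fun n => Nat.rec base (fun n Γ => g n Γ) n
  have hfs : ∀ n, f (n + 1) = g n (f n) := fun n => rfl
  have hmono : Monotone fun n => (f n).1 := monotone_nat_of_le_succ fun n => by
    rw [hfs]; exact hg1 n (f n)
  let Γ : Submodule ℝ (X × Y) := ⨆ n, (f n).1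
  have hmem : ∀ z, z ∈ Γ ↔ ∃ n, z ∈ (f n).1 := fun z =>
    Submodule.mem_iSup_of_directed _ hmono.directed_le
  have hb : ∀ z ∈ Γ.topologicalClosure,
      ‖z.1‖ ≤ (1 + ε) * ‖z.2‖ ∧ ‖z.2‖ ≤ (1 + ε) * ‖z.1‖ := by
    intro z hz
    have hcl : IsClosed {z : X × Y |
        ‖z.1‖ ≤ (1 + ε) * ‖z.2‖ ∧ ‖z.2‖ ≤ (1 + ε) * ‖z.1‖} :=
      by
        rw [Set.ofPred_and]
        exact IsClosed.inter (isClosed_le (by fun_prop) (by fun_prop))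
          (isClosed_le (by fun_prop) (by fun_prop))
    refine closure_minimal (fun w hw => ?_) hcl hz
    obtain ⟨n, hn⟩ := (hmem w).1 hw
    obtain ⟨h1, h2⟩ := (f n).2.2 w hn
    exact ⟨h1.trans (by gcongr; exact hc3 n), h2.trans (by gcongr; exact hc3 n)⟩
  obtain ⟨T, hT1, hT2⟩ := rel_to_map (by linarith : 1 ≤ 1 + ε) Γ.topologicalClosure
    Γ.isClosed_topologicalClosure hb
    ((denseRange_denseSeq X).mono (by
      rintro _ ⟨n, rfl⟩
      obtain ⟨y, hy⟩ := hg2 n (f n)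
      exact ⟨_, Γ.le_topologicalClosure ((hmem _).2 ⟨n + 1, hy⟩), rfl⟩))
    ((denseRange_denseSeq Y).mono (by
      rintro _ ⟨n, rfl⟩
      obtain ⟨y, hy⟩ := hg3 n (f n)
      exact ⟨_, Γ.le_topologicalClosure ((hmem _).2 ⟨n + 1, hy⟩), rfl⟩))
  refine ⟨T, hT1, fun x => ⟨?_, (hT2 x).2⟩⟩
  rw [inv_mul_le_iff₀ (by linarith)]
  exact (hT2 x).1

lemma sep_tuples {X : Type*} [NormedAddCommGroup X] [NormedSpace ℝ X] (Q : Set X)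
    (hQ : Q.Countable) (k : ℕ) : ∃ A : Set (Fin k → X), A.Countable ∧
      ∀ (x : Fin k → X) (r : ℕ) (d : Fin r → X) (t : Fin r → Fin k → ℝ), (∀ i, d i ∈ Q) →
      ∀ θ : ℝ, 0 < θ → ∃ x' ∈ A, ∀ i,
        |‖d i + ∑ j, t i j • x' j‖ - ‖d i + ∑ j, t i j • x j‖| < θ := by
  have : Countable Q := hQ.to_subtype
  let Φ : (Fin k → X) → (Q → C(Fin k → ℝ, ℝ)) := fun x d =>
    ⟨fun t => ‖(d : X) + ∑ j, t j • x j‖, by fun_prop⟩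
  let τ : TopologicalSpace (Fin k → X) := TopologicalSpace.induced Φ inferInstance
  have hind : @Topology.IsInducing _ _ τ _ Φ := @Topology.IsInducing.mk _ _ τ _ Φ rfl
  have hsc : @SecondCountableTopology _ τ :=
    @Topology.IsInducing.secondCountableTopology _ _ τ Φ _ _ hind
  obtain ⟨A, hA1, hA2⟩ := @TopologicalSpace.exists_countable_dense _ τ
    (@TopologicalSpace.SecondCountableTopology.to_separableSpace _ τ hsc)
  refine ⟨A, hA1, fun x r d t hd θ hθ => ?_⟩
  let U : Set (Q → C(Fin k → ℝ, ℝ)) := ⋂ i : Fin r,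
    {φ | |φ ⟨d i, hd i⟩ (t i) - ‖d i + ∑ j, t i j • x j‖| < θ}
  have hU : IsOpen U := isOpen_iInter_of_finite fun i =>
    isOpen_lt (by
      have h1 : Continuous fun φ : Q → C(Fin k → ℝ, ℝ) => φ ⟨d i, hd i⟩ := continuous_apply _
      have h2 := (ContinuousEvalConst.continuous_eval_const (F := C(Fin k → ℝ, ℝ)) (t i)).comp h1
      exact (h2.sub continuous_const).abs) continuous_const
  have hV : @IsOpen _ τ (Φ ⁻¹' U) := ⟨U, hU, rfl⟩
  obtain ⟨x', h1, h2⟩ := @Dense.inter_open_nonempty _ τ _ hA2 _ hV ⟨x, by simp [U, Φ, hθ]⟩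
  refine ⟨x', h2, fun i => ?_⟩
  exact Set.mem_iInter.1 h1 i

lemma sep_step {X : Type*} [NormedAddCommGroup X] [NormedSpace ℝ X] (Z : Submodule ℝ X)
    (hZ : IsSeparable (Z : Set X)) : ∃ Z' : Submodule ℝ X, IsSeparable (Z' : Set X) ∧ Z ≤ Z' ∧
      ∀ (k : ℕ) (x : Fin k → X) (r : ℕ) (d : Fin r → X) (t : Fin r → Fin k → ℝ),
      (∀ i, d i ∈ Z) → ∀ θ : ℝ, 0 < θ → ∃ x' : Fin k → X, (∀ j, x' j ∈ Z') ∧ ∀ i,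
        |‖d i + ∑ j, t i j • x' j‖ - ‖d i + ∑ j, t i j • x j‖| < θ := by
  obtain ⟨Q, hQ1, hQ2⟩ := hZ
  choose A hA1 hA2 using fun k => sep_tuples Q hQ1 k
  let S : Set X := ⋃ k, ⋃ x ∈ A k, Set.range x
  have hS : S.Countable := Set.countable_iUnion fun k =>
    (hA1 k).biUnion fun x _ => Set.countable_range x
  refine ⟨Submodule.span ℝ ((Z : Set X) ∪ S),
    (IsSeparable.union ⟨Q, hQ1, hQ2⟩ hS.isSeparable).span, ?_, ?_⟩
  · exact fun z hz => Submodule.subset_span (Or.inl hz)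
  intro k x r d t hd θ hθ
  have : ∀ i, ∃ q ∈ Q, dist (d i) q < θ / 3 := fun i =>
    Metric.mem_closure_iff.1 (hQ2 (hd i)) _ (by linarith)
  choose q hq1 hq2 using this
  obtain ⟨x', h1, h2⟩ := hA2 k x r q t hq1 (θ / 3) (by linarith)
  refine ⟨x', fun j => Submodule.subset_span (Or.inr ?_), fun i => ?_⟩
  · exact Set.mem_iUnion.2 ⟨k, Set.mem_iUnion₂.2 ⟨x', h1, j, rfl⟩⟩
  · have key : ∀ w : X, |‖d i + w‖ - ‖q i + w‖| ≤ dist (d i) (q i) := fun w => by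
      refine (abs_norm_sub_norm_le _ _).trans (le_of_eq ?_)
      rw [dist_eq_norm]; congr 1; abel
    have k1 := abs_le.1 (key (∑ j, t i j • x' j))
    have k2 := abs_le.1 (key (∑ j, t i j • x j))
    have k3 := abs_lt.1 (h2 i)
    have k4 := hq2 i
    rw [abs_lt]
    constructor <;> linarith [k1.1, k1.2, k2.1, k2.2, k3.1, k3.2]

lemma sep_limit {X : Type*} [NormedAddCommGroup X] [NormedSpace ℝ X] (Z₀ : Submodule ℝ X)
    (hZ₀ : IsSeparable (Z₀ : Set X)) : ∃ Z : Submodule ℝ X, IsSeparable (Z : Set X) ∧ Z₀ ≤ Z ∧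
      ∀ (k : ℕ) (x : Fin k → X) (r : ℕ) (d : Fin r → X) (t : Fin r → Fin k → ℝ),
      (∀ i, d i ∈ Z) → ∀ θ : ℝ, 0 < θ → ∃ x' : Fin k → X, (∀ j, x' j ∈ Z) ∧ ∀ i,
        |‖d i + ∑ j, t i j • x' j‖ - ‖d i + ∑ j, t i j • x j‖| < θ := by
  have step : ∀ Z : {Z : Submodule ℝ X // IsSeparable (Z : Set X)},
      ∃ Z' : {Z : Submodule ℝ X // IsSeparable (Z : Set X)}, Z.1 ≤ Z'.1 ∧
      ∀ (k : ℕ) (x : Fin k → X) (r : ℕ) (d : Fin r → X) (t : Fin r → Fin k → ℝ),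
      (∀ i, d i ∈ Z.1) → ∀ θ : ℝ, 0 < θ → ∃ x' : Fin k → X, (∀ j, x' j ∈ Z'.1) ∧ ∀ i,
        |‖d i + ∑ j, t i j • x' j‖ - ‖d i + ∑ j, t i j • x j‖| < θ := by
    rintro ⟨Z, hZ⟩
    obtain ⟨Z', h1, h2, h3⟩ := sep_step Z hZ
    exact ⟨⟨Z', h1⟩, h2, h3⟩
  choose g hg1 hg2 using step
  let f : ℕ → {Z : Submodule ℝ X // IsSeparable (Z : Set X)} :=
    fun n => Nat.rec ⟨Z₀, hZ₀⟩ (fun _ Z => g Z) n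
  have hfs : ∀ n, f (n + 1) = g (f n) := fun n => rfl
  have hmono : Monotone fun n => (f n).1 := monotone_nat_of_le_succ fun n => by
    rw [hfs]; exact hg1 (f n)
  have hmem : ∀ z, z ∈ (⨆ n, (f n).1) ↔ ∃ n, z ∈ (f n).1 := fun z =>
    Submodule.mem_iSup_of_directed _ hmono.directed_le
  refine ⟨⨆ n, (f n).1, ?_, le_iSup (fun n => (f n).1) 0, ?_⟩
  · rw [Submodule.coe_iSup_of_directed _ hmono.directed_le]
    exact IsSeparable.iUnion fun n => (f n).2
  · intro k x r d t hd θ hθ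
    choose n hn using fun i => (hmem _).1 (hd i)
    let N := Finset.univ.sup n
    obtain ⟨x', h1, h2⟩ := hg2 (f N) k x r d t
      (fun i => hmono (Finset.le_sup (Finset.mem_univ i)) (hn i)) θ hθ
    exact ⟨x', fun j => (hmem _).2 ⟨N + 1, h1 j⟩, h2⟩

lemma net_lemma {E Y : Type*} [NormedAddCommGroup E] [NormedSpace ℝ E] [FiniteDimensional ℝ E]
    [NormedAddCommGroup Y] [NormedSpace ℝ Y] (T : E →ₗ[ℝ] Y) {ε θ : ℝ} (hε : 0 < ε)
    (hθ : 0 < θ) (hθε : θ * (9 * (1 + ε)) = ε) (t : Set E)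
    (ht : t ⊆ Metric.closedBall 0 1) (hcov : Metric.closedBall 0 1 ⊆ ⋃ x ∈ t, Metric.ball x θ)
    (hT : ∀ v ∈ t, |‖T v‖ - ‖v‖| ≤ 3 * θ) : IsEpsIsometry ε T := by
  let T' : E →L[ℝ] Y := LinearMap.toContinuousLinearMap T
  have hT' : ∀ v, T v = T' v := fun v => rfl
  have hθ1 : θ ≤ 1 / 9 := by nlinarith
  have hθ2 : 9 * θ ≤ ε := by nlinarith
  have hM0 := norm_nonneg T'
  have key : ∀ u : E, ‖u‖ = 1 → ‖T u‖ ≤ 1 + 3 * θ + ‖T'‖ * θ ∧ 1 - 4 * θ - ‖T'‖ * θ ≤ ‖T u‖ := by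
    intro u hu
    obtain ⟨v, hv, huv⟩ := Set.mem_iUnion₂.1 (hcov (by simp [hu] : u ∈ Metric.closedBall 0 1))
    rw [Metric.mem_ball, dist_eq_norm] at huv
    have h1 : ‖v‖ ≤ 1 := by simpa using ht hv
    have h2 := abs_le.1 (hT v hv)
    have h3 : ‖T u - T v‖ ≤ ‖T'‖ * θ := by
      rw [← map_sub, hT']
      exact (T'.le_opNorm _).trans (by gcongr)
    have h4 := abs_le.1 ((abs_norm_sub_norm_le (T u) (T v)).trans h3)
    have h5 := abs_le.1 ((abs_norm_sub_norm_le u v).trans huv.le)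
    constructor <;> linarith [h2.1, h2.2, h4.1, h4.2, h5.1, h5.2]
  have hM : ‖T'‖ ≤ 1 + 3 * θ + ‖T'‖ * θ :=
    ContinuousLinearMap.opNorm_le_of_unit_norm (by positivity) fun u hu => (key u hu).1
  have hM1 : ‖T'‖ ≤ 1 + 8 * θ := by nlinarith
  have hlow : ∀ u : E, ‖u‖ = 1 → (1 + ε)⁻¹ ≤ ‖T u‖ := fun u hu => by
    have h1 := (key u hu).2
    have h2 : (1 + ε)⁻¹ = 1 - 9 * θ := by
      apply inv_eq_of_mul_eq_one_right
      linarith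
    rw [h2]
    nlinarith
  intro x
  constructor
  · rcases eq_or_ne x 0 with rfl | hx
    · simp
    have hx' : 0 < ‖x‖ := norm_pos_iff.2 hx
    have h1 := hlow (‖x‖⁻¹ • x) (by rw [norm_smul, norm_inv, norm_norm, inv_mul_cancel₀ hx'.ne'])
    rw [map_smul, norm_smul, norm_inv, norm_norm] at h1
    rwa [inv_mul_eq_div, le_div_iff₀ hx'] at h1
  · rw [hT']
    refine (T'.le_opNorm x).trans ?_
    gcongr
    linarith

lemma exists_aiIdeal {X : Type*} [NormedAddCommGroup X] [NormedSpace ℝ X]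
    (Z₀ : Submodule ℝ X) (hZ₀ : IsSeparable (Z₀ : Set X)) :
    ∃ Y : Submodule ℝ X, IsAIIdeal Y ∧ SeparableSpace Y ∧ Z₀ ≤ Y := by
  obtain ⟨Z, hZ1, hZ2, hZ3⟩ := sep_limit Z₀ hZ₀
  let Y := Z.topologicalClosure
  have hZY : Z ≤ Y := Z.le_topologicalClosure
  refine ⟨Y, ⟨Z.isClosed_topologicalClosure, ?_⟩, ?_, hZ2.trans hZY⟩
  swap
  · have : IsSeparable (Y : Set X) := hZ1.closure
    exact this.separableSpace
  intro ε hε E hE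
  let θ := ε / (9 * (1 + ε))
  have hθ : 0 < θ := by positivity
  have hθε : θ * (9 * (1 + ε)) = ε := by simp only [θ]; field_simp
  let B : Submodule ℝ E := Y.comap E.subtype
  obtain ⟨W, hW⟩ := B.exists_isCompl
  have : ProperSpace E := FiniteDimensional.proper ℝ E
  obtain ⟨s, hs1, hs2, hs3⟩ := (isCompact_closedBall (0 : E) 1).finite_cover_balls hθ
  have hdec : ∀ v : E, ∃ (b : B) (w : W), (b : E) + w = v := fun v => by
    have : v ∈ B ⊔ W := by rw [hW.sup_eq_top]; trivial
    obtain ⟨b, hb, w, hw, h⟩ := Submodule.mem_sup.1 this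
    exact ⟨⟨b, hb⟩, ⟨w, hw⟩, h⟩
  choose bb ww hbw using hdec
  have happ : ∀ v : E, ∃ d ∈ Z, dist ((bb v : E) : X) d < θ := fun v =>
    Metric.mem_closure_iff.1 (bb v).2 θ hθ
  choose dd hd1 hd2 using happ
  let β := Module.finBasis ℝ W
  obtain ⟨r, v, hv⟩ := hs2.fin_param
  obtain ⟨x', hx1, hx2⟩ := hZ3 _ (fun j => ((β j : E) : X)) r (fun i => dd (v i))
    (fun i j => β.repr (ww (v i)) j) (fun i => hd1 _) θ hθ
  let φ : W →ₗ[ℝ] Y := β.constr ℝ fun j => (⟨x' j, hZY (hx1 j)⟩ : Y)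
  let ι : B →ₗ[ℝ] Y := E.subtype.restrict (fun x hx => hx)
  let T : E →ₗ[ℝ] Y := LinearMap.ofIsCompl hW ι φ
  have hTB : ∀ b : B, ((T b : Y) : X) = ((b : E) : X) := fun b => by
    simp only [T, LinearMap.ofIsCompl_apply_left]; rfl
  have hTW : ∀ w : W, ((T w : Y) : X) = ∑ j, β.repr w j • x' j := fun w => by
    simp only [T, LinearMap.ofIsCompl_apply_right, φ, Module.Basis.constr_apply_fintype]
    simp
  have hWs : ∀ w : W, ((w : E) : X) = ∑ j, β.repr w j • ((β j : E) : X) := fun w => by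
    have h := congrArg (fun w : W => ((w : E) : X)) (β.sum_repr w)
    simp only [Submodule.coe_sum, Submodule.coe_smul] at h
    exact h.symm
  refine ⟨T, fun e he => hTB ⟨e, he⟩, net_lemma T hε hθ hθε s hs1 hs3 ?_⟩
  intro u hu
  obtain ⟨i, rfl⟩ := hv.2.symm ▸ hu
  have h1 : ‖T (v i)‖ = ‖((bb (v i) : E) : X) + ∑ j, β.repr (ww (v i)) j • x' j‖ := by
    rw [← hTW, ← hTB, ← Submodule.coe_add, ← map_add, hbw]; rfl
  have h2 : ‖v i‖ = ‖((bb (v i) : E) : X) + ∑ j, β.repr (ww (v i)) j • ((β j : E) : X)‖ := by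
    rw [← hWs, ← Submodule.coe_add, hbw]; rfl
  have key : ∀ w : X, |‖((bb (v i) : E) : X) + w‖ - ‖dd (v i) + w‖| ≤ θ := fun w => by
    refine (abs_norm_sub_norm_le _ _).trans (le_trans (le_of_eq ?_) (hd2 (v i)).le)
    rw [dist_eq_norm]; congr 1; abel
  have k1 := abs_le.1 (key (∑ j, β.repr (ww (v i)) j • x' j))
  have k2 := abs_le.1 (key (∑ j, β.repr (ww (v i)) j • ((β j : E) : X)))
  have k3 := abs_lt.1 (hx2 i)
  rw [h1, h2, abs_le]
  constructor <;> linarith [k1.1, k1.2, k2.1, k2.2, k3.1, k3.2]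

lemma gur_of_aiIdeal {X : Type*} [NormedAddCommGroup X] [NormedSpace ℝ X] (hX : IsGurariy X)
    (Y : Submodule ℝ X) (hY : IsAIIdeal Y) : IsGurariy Y := by
  intro ε hε F _ _ _ E T hT
  -- choose δ with (1+δ)^2 ≤ 1+ε
  obtain ⟨δ, hδ, hδε⟩ : ∃ δ : ℝ, 0 < δ ∧ (1 + δ) * (1 + δ) ≤ 1 + ε := by
    refine ⟨min 1 (ε / 3), by positivity, ?_⟩
    have h1 := min_le_left 1 (ε / 3)
    have h2 := min_le_right 1 (ε / 3)
    have h3 : 0 < min 1 (ε / 3) := by positivity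
    nlinarith
  obtain ⟨S, hS1, hS2⟩ := hX δ hδ F E (Y.subtype ∘ₗ T) (fun e => hT e)
  obtain ⟨R, hR1, hR2⟩ := hY.2 δ hδ (LinearMap.range S) inferInstance
  refine ⟨R ∘ₗ S.rangeRestrict, fun e => ?_, fun x => ?_⟩
  · apply Subtype.ext
    have h : (S.rangeRestrict (e : F) : X) = T e := hS1 e
    rw [LinearMap.comp_apply, hR1 _ (by rw [h]; exact (T e).2), h]
  · obtain ⟨h1, h2⟩ := hS2 x
    obtain ⟨h3, h4⟩ := hR2 (S.rangeRestrict x)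
    have h5 : ‖S.rangeRestrict x‖ = ‖S x‖ := rfl
    rw [h5] at h3 h4
    have hp : 0 < 1 + δ := by linarith
    rw [inv_mul_le_iff₀ hp] at h1 h3
    rw [inv_mul_le_iff₀ (by linarith), LinearMap.comp_apply]
    constructor
    · calc ‖x‖ ≤ (1 + δ) * ((1 + δ) * ‖R (S.rangeRestrict x)‖) := h1.trans (by gcongr)
        _ = ((1 + δ) * (1 + δ)) * ‖R (S.rangeRestrict x)‖ := by ring
        _ ≤ _ := by gcongr
    · calc _ ≤ (1 + δ) * ((1 + δ) * ‖x‖) := h4.trans (by gcongr)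
        _ = ((1 + δ) * (1 + δ)) * ‖x‖ := by ring
        _ ≤ _ := by gcongr

/-- A (possibly non-separable) Banach space `X` is a Gurariy space if and only if
every separable almost isometric ideal in `X` is almost isometric to the separable
Gurariy space `G`. -/
theorem gurariy_iff_separable_aiIdeals_almost_isometric
    (G : Type*) [NormedAddCommGroup G] [NormedSpace ℝ G] [CompleteSpace G]
    [SeparableSpace G] (hG : IsGurariy G)
    (X : Type*) [NormedAddCommGroup X] [NormedSpace ℝ X] [CompleteSpace X] :
    IsGurariy X ↔
      ∀ Y : Subspace ℝ X, IsAIIdeal Y → SeparableSpace Y → AlmostIsometric Y G := by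
  constructor
  · intro hX Y hY hsep
    have : CompleteSpace Y := hY.1.completeSpace_coe
    exact gur_unique (gur_of_aiIdeal hX Y hY) hG
  · intro h ε hε F _ _ _ E T hT
    obtain ⟨δ, hδ, hδε⟩ : ∃ δ : ℝ, 0 < δ ∧ (1 + δ) * (1 + 2 * δ) ≤ 1 + ε := by
      refine ⟨min 1 (ε / 5), by positivity, ?_⟩
      have h1 := min_le_left 1 (ε / 5)
      have h2 := min_le_right 1 (ε / 5)
      have h3 : 0 < min 1 (ε / 5) := by positivity
      nlinarith
    have hp : 0 < 1 + δ := by linarith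
    have hsepT : IsSeparable (LinearMap.range T : Set X) := by
      have : ProperSpace (LinearMap.range T) := FiniteDimensional.proper ℝ _
      exact IsSeparable.of_subtype _
    obtain ⟨Y, hY1, hY2, hY3⟩ := exists_aiIdeal (LinearMap.range T) hsepT
    obtain ⟨R, hR1, hR2⟩ := h Y hY1 hY2 δ hδ
    have hRb : ∀ y, ‖R y‖ ≤ (1 + δ) * ‖y‖ ∧ ‖y‖ ≤ (1 + δ) * ‖R y‖ := fun y => by
      obtain ⟨h1, h2⟩ := hR2 y
      rw [inv_mul_le_iff₀ hp] at h1
      exact ⟨h2, h1⟩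
    have hinj : Function.Injective R := by
      rw [← LinearMap.ker_eq_bot, LinearMap.ker_eq_bot']
      intro y hy
      have := (hRb y).2
      rw [hy] at this
      simpa using this
    let e : Y ≃ₗ[ℝ] G := LinearEquiv.ofBijective R ⟨hinj, hR1⟩
    have he : ∀ y, e y = R y := fun y => rfl
    let T₁ : E →ₗ[ℝ] Y := T.codRestrict Y (fun x => hY3 ⟨x, rfl⟩)
    have hT₁ : ∀ x, ‖T₁ x‖ = ‖(x : F)‖ := fun x => hT x
    obtain ⟨S, hS1, hS2⟩ := gur3 hG (normSeminorm ℝ F) (fun x hx => by simpa using hx) E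
      (R ∘ₗ T₁) (by linarith : 1 ≤ 1 + δ) (by linarith : 1 + δ < 1 + 2 * δ) (fun x => by
        have := hRb (T₁ x)
        rw [hT₁] at this
        exact this)
    refine ⟨Y.subtype ∘ₗ e.symm.toLinearMap ∘ₗ S, fun x => ?_, fun x => ?_⟩
    · have h1 : e.symm (S x) = T₁ x := by
        rw [LinearEquiv.symm_apply_eq, hS1]; rfl
      simp only [LinearMap.comp_apply, LinearEquiv.coe_coe, h1]
      rfl
    · obtain ⟨y, hy⟩ := e.surjective (S x)
      have h1 : ‖(Y.subtype ∘ₗ e.symm.toLinearMap ∘ₗ S) x‖ = ‖y‖ := by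
        simp only [LinearMap.comp_apply, LinearEquiv.coe_coe, ← hy, LinearEquiv.symm_apply_apply]
        rfl
      rw [h1, inv_mul_le_iff₀ (by linarith)]
      obtain ⟨h2, h3⟩ := hS2 x
      rw [← hy, he] at h2 h3
      change _ ≤ _ * ‖x‖ at h2
      change ‖x‖ ≤ _ at h3
      obtain ⟨h4, h5⟩ := hRb y
      constructor
      · calc ‖x‖ ≤ (1 + 2 * δ) * ((1 + δ) * ‖y‖) := h3.trans (by gcongr)
          _ = ((1 + δ) * (1 + 2 * δ)) * ‖y‖ := by ring
          _ ≤ _ := by gcongr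
      · calc ‖y‖ ≤ (1 + δ) * ((1 + 2 * δ) * ‖x‖) := h5.trans (by gcongr)
          _ = ((1 + δ) * (1 + 2 * δ)) * ‖x‖ := by ring
          _ ≤ _ := by gcongr
end

section
/- A real Banach space X is a Gurariy space if and only if for every real Banach space Z and every linear isometric embedding i : X → Z whose range is a closed subspace of Z of codimension one (a closed hyperplane), the image i(X) is an almost isometric ideal in Z. -/
open TopologicalSpace

/-- A bare copy of `ℝⁿ`, carrying no preferred norm. -/
def BareCopy (n : ℕ) : Type := Fin n → ℝ

noncomputable instance (n : ℕ) : AddCommGroup (BareCopy n) :=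
  inferInstanceAs (AddCommGroup (Fin n → ℝ))

noncomputable instance (n : ℕ) : Module ℝ (BareCopy n) :=
  inferInstanceAs (Module ℝ (Fin n → ℝ))

instance (n : ℕ) : FiniteDimensional ℝ (BareCopy n) :=
  inferInstanceAs (FiniteDimensional ℝ (Fin n → ℝ))

/-- A Gurariy space has the extension property for finite-dimensional spaces in any universe. -/
theorem IsGurariy.extend {X : Type*} [NormedAddCommGroup X] [NormedSpace ℝ X]
    (hX : IsGurariy X) {ε : ℝ} (hε : 0 < ε) {E : Type*} [NormedAddCommGroup E] [NormedSpace ℝ E]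
    [FiniteDimensional ℝ E] (H : Subspace ℝ E) (T : H →ₗ[ℝ] X) (hT : ∀ e : H, ‖T e‖ = ‖e‖) :
    ∃ S : E →ₗ[ℝ] X, (∀ e : H, S e = T e) ∧ IsEpsIsometry ε ⇑S := by
  let b : E ≃ₗ[ℝ] BareCopy (Module.finrank ℝ E) := (Module.finBasis ℝ E).equivFun
  letI i1 : NormedAddCommGroup (BareCopy (Module.finrank ℝ E)) :=
    NormedAddCommGroup.induced _ E b.symm.toLinearMap b.symm.injective
  letI i2 : NormedSpace ℝ (BareCopy (Module.finrank ℝ E)) :=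
    NormedSpace.induced ℝ _ E b.symm.toLinearMap
  have hn : ∀ y : BareCopy (Module.finrank ℝ E), ‖y‖ = ‖b.symm y‖ := fun y => rfl
  let H' : Subspace ℝ (BareCopy (Module.finrank ℝ E)) := H.comap b.symm.toLinearMap
  let r : H' →ₗ[ℝ] H := b.symm.toLinearMap.restrict (fun x hx => hx)
  obtain ⟨S, hS1, hS2⟩ := hX ε hε _ H' (T ∘ₗ r) (fun e => by
    rw [LinearMap.comp_apply, hT]; rfl)
  refine ⟨S ∘ₗ b.toLinearMap, fun e => ?_, fun x => ?_⟩
  · have := hS1 ⟨b e, by simp [H']⟩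
    simp only [LinearMap.comp_apply, LinearEquiv.coe_coe] at this ⊢
    rw [this]
    congr 1
    ext
    simp [r]
  · have := hS2 (b x)
    rw [hn, b.symm_apply_apply] at this
    exact this

theorem gurariy_forward {X Z : Type*} [NormedAddCommGroup X] [NormedSpace ℝ X]
    [NormedAddCommGroup Z] [NormedSpace ℝ Z] (hX : IsGurariy X)
    (i : X →ₗ[ℝ] Z) (hi : ∀ x : X, ‖i x‖ = ‖x‖)
    (hcl : IsClosed ((LinearMap.range i : Subspace ℝ Z) : Set Z)) :
    IsAIIdeal (LinearMap.range i) := by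
  refine ⟨hcl, fun ε hε E hE => ?_⟩
  have hinj : Function.Injective i := by
    rw [injective_iff_map_eq_zero]
    intro x hx
    rw [← norm_eq_zero, ← hi, hx, norm_zero]
  let e := LinearEquiv.ofInjective i hinj
  have he : ∀ x, ((e x : LinearMap.range i) : Z) = i x := fun x => rfl
  let H : Subspace ℝ E := (LinearMap.range i).comap E.subtype
  let r : H →ₗ[ℝ] LinearMap.range i := E.subtype.restrict (fun x hx => hx)
  have hsymm : ∀ y, ‖e.symm y‖ = ‖y‖ := by
    intro y
    rw [← hi, ← he, e.apply_symm_apply]; rfl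
  obtain ⟨S, hS1, hS2⟩ := hX.extend hε H (e.symm.toLinearMap ∘ₗ r) (fun x => by
    rw [LinearMap.comp_apply, LinearEquiv.coe_coe, hsymm]; rfl)
  refine ⟨e.toLinearMap ∘ₗ S, fun x hx => ?_, fun x => ?_⟩
  · have := hS1 ⟨x, hx⟩
    simp only [LinearMap.comp_apply, LinearEquiv.coe_coe] at this ⊢
    rw [this, e.apply_symm_apply]
    rfl
  · have h2 : ‖(e.toLinearMap ∘ₗ S) x‖ = ‖S x‖ := by
      rw [← hi (S x)]; rfl
    rw [h2]
    exact hS2 x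

/-- The hyperplane condition. -/
def HyperplaneCond (X : Type u) [NormedAddCommGroup X] [NormedSpace ℝ X] : Prop :=
  ∀ (Z : Type u) [NormedAddCommGroup Z] [NormedSpace ℝ Z] [CompleteSpace Z]
        (i : X →ₗ[ℝ] Z),
        (∀ x : X, ‖i x‖ = ‖x‖) →
        IsClosed ((LinearMap.range i : Subspace ℝ Z) : Set Z) →
        Module.finrank ℝ (Z ⧸ LinearMap.range i) = 1 →
        IsAIIdeal (LinearMap.range i)

theorem le_norm_quot {M : Type*} [SeminormedAddCommGroup M] [NormedSpace ℝ M]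
    (S : Submodule ℝ M) (m : M) (a : ℝ) (h : ∀ s ∈ S, a ≤ ‖m + s‖) :
    a ≤ ‖(Submodule.Quotient.mk m : M ⧸ S)‖ := by
  refine le_of_forall_pos_le_add fun δ hδ => ?_
  obtain ⟨n, hn, hlt⟩ := Submodule.Quotient.norm_mk_lt (Submodule.Quotient.mk m : M ⧸ S) hδ
  have := h (n - m) ((Submodule.Quotient.eq S).1 hn)
  rw [add_sub_cancel] at this
  linarith

/-- Amalgamation: the pushout of `X` and `F` along a hyperplane of `F`. -/
theorem exists_pushout (X : Type u) [NormedAddCommGroup X] [NormedSpace ℝ X] [CompleteSpace X]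
    (F : Type) [NormedAddCommGroup F] [NormedSpace ℝ F] [FiniteDimensional ℝ F]
    (φ : F →ₗ[ℝ] ℝ) (f0 : F) (hf0 : φ f0 = 1) (T : LinearMap.ker φ →ₗ[ℝ] X) (c : ℝ) (hc : 1 ≤ c)
    (hT1 : ∀ e, c⁻¹ * ‖e‖ ≤ ‖T e‖) (hT2 : ∀ e, ‖T e‖ ≤ c * ‖e‖) :
    ∃ (Z : Type u) (_ : NormedAddCommGroup Z) (_ : NormedSpace ℝ Z) (_ : CompleteSpace Z)
      (i : X →ₗ[ℝ] Z) (k : F →ₗ[ℝ] Z), (∀ x, ‖i x‖ = ‖x‖) ∧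
        Module.finrank ℝ (Z ⧸ LinearMap.range i) = 1 ∧
        (∀ e : LinearMap.ker φ, k e = i (T e)) ∧
        (∀ f, c⁻¹ * ‖f‖ ≤ ‖k f‖) ∧ (∀ f, ‖k f‖ ≤ c * ‖f‖) := by
  have hc0 : 0 < c := by linarith
  have hci : c⁻¹ ≤ c := (inv_le_one_of_one_le₀ hc).trans hc
  let W := WithLp 1 (X × F)
  let L : (X × F) →ₗ[ℝ] W := (WithLp.linearEquiv 1 ℝ (X × F)).symm.toLinearMap
  have hL : ∀ x f, ‖L (x, f)‖ = ‖x‖ + ‖f‖ := fun x f => WithLp.prod_norm_eq_of_L1 _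
  let κ : LinearMap.ker φ →ₗ[ℝ] W := L ∘ₗ (T.prod (-(c • (LinearMap.ker φ).subtype)))
  have hκ : ∀ e, κ e = L (T e, -(c • (e : F))) := fun e => rfl
  let K : Submodule ℝ W := LinearMap.range κ
  haveI hK : IsClosed (K : Set W) := Submodule.closed_of_finiteDimensional K
  let i : X →ₗ[ℝ] (W ⧸ K) := K.mkQ ∘ₗ L ∘ₗ LinearMap.inl ℝ X F
  let k : F →ₗ[ℝ] (W ⧸ K) := K.mkQ ∘ₗ L ∘ₗ LinearMap.inr ℝ X F ∘ₗ (c • LinearMap.id)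
  have hi : ∀ x, i x = Submodule.Quotient.mk (L (x, 0)) := fun x => rfl
  have hk : ∀ f, k f = Submodule.Quotient.mk (L (0, c • f)) := fun x => rfl
  have hki : ∀ e : LinearMap.ker φ, k e = i (T e) := by
    intro e
    rw [hk, hi, Submodule.Quotient.eq]
    refine ⟨-e, ?_⟩
    rw [hκ, ← map_sub]
    congr 1
    simp
  refine ⟨W ⧸ K, inferInstance, inferInstance, inferInstance, i, k, ?_, ?_, hki, ?_, ?_⟩
  · intro x
    apply le_antisymm
    · rw [hi]
      refine (Submodule.Quotient.norm_mk_le K _).trans ?_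
      rw [hL]; simp
    · rw [hi]
      apply le_norm_quot
      rintro _ ⟨e, rfl⟩
      rw [hκ, ← map_add, Prod.mk_add_mk, hL]
      have h1 : ‖x‖ ≤ ‖x + T e‖ + ‖T e‖ := by
        simpa using norm_sub_le (x + T e) (T e)
      have h2 := hT2 e
      have h3 : ‖0 + -(c • (e : F))‖ = c * ‖e‖ := by
        rw [zero_add, norm_neg, norm_smul, Real.norm_of_nonneg hc0.le]; rfl
      rw [h3]
      linarith
  · rw [finrank_eq_one_iff']
    refine ⟨Submodule.Quotient.mk (k f0), ?_, ?_⟩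
    · intro h
      rw [Submodule.Quotient.mk_eq_zero] at h
      obtain ⟨x, hx⟩ := h
      rw [hk, hi, Submodule.Quotient.eq] at hx
      obtain ⟨e, he⟩ := hx
      rw [hκ, ← map_sub] at he
      have he' := (WithLp.linearEquiv 1 ℝ (X × F)).symm.injective he
      have h2 : -(c • (e : F)) = 0 - c • f0 := congrArg Prod.snd he'
      have h3 := congrArg φ h2
      have h4 : φ (e : F) = 0 := e.2
      simp [h4, hf0] at h3
      exact hc0.ne' h3
    · intro w
      obtain ⟨z, rfl⟩ := Submodule.Quotient.mk_surjective _ w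
      obtain ⟨m, rfl⟩ := Submodule.Quotient.mk_surjective _ z
      obtain ⟨⟨x, f⟩, rfl⟩ : ∃ p, L p = m := (WithLp.linearEquiv 1 ℝ (X × F)).symm.surjective m
      refine ⟨c⁻¹ * φ f, ?_⟩
      rw [← Submodule.Quotient.mk_smul, Submodule.Quotient.eq]
      let e : LinearMap.ker φ := ⟨c⁻¹ • (f - φ f • f0), by simp [hf0]⟩
      refine ⟨-(x + T e), ?_⟩
      have hz : (Submodule.Quotient.mk (L (x, f)) : W ⧸ K) = i x + k (c⁻¹ • f) := by
        rw [hi, hk, ← Submodule.Quotient.mk_add, ← map_add]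
        simp [smul_smul, hc0.ne']
      have he : (e : F) = c⁻¹ • f - (c⁻¹ * φ f) • f0 := by
        simp [e, smul_sub, smul_smul]
      rw [hz, map_neg, map_add, ← hki, he, map_sub, map_smul k (c⁻¹ * φ f)]
      abel
  · intro f
    rw [hk]
    apply le_norm_quot
    rintro _ ⟨e, rfl⟩
    rw [hκ, ← map_add, Prod.mk_add_mk, hL, zero_add, ← sub_eq_add_neg, ← smul_sub, norm_smul,
      Real.norm_of_nonneg hc0.le]
    have h1 := hT1 e
    have h2 : ‖f‖ ≤ ‖(e : F)‖ + ‖f - e‖ := by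
      simpa using norm_add_le (e : F) (f - e)
    have h3 : c⁻¹ * ‖f‖ ≤ c⁻¹ * (‖(e : F)‖ + ‖f - e‖) := by gcongr
    have h4 : c⁻¹ * ‖f - e‖ ≤ c * ‖f - e‖ := by gcongr
    have h5 : ‖(e : F)‖ = ‖e‖ := rfl
    rw [h5] at h3
    linarith
  · intro f
    rw [hk]
    refine (Submodule.Quotient.norm_mk_le K _).trans ?_
    rw [hL, norm_smul, Real.norm_of_nonneg hc0.le]; simp

/-- One-dimensional extension step. -/
theorem extension_step (X : Type u) [NormedAddCommGroup X] [NormedSpace ℝ X] [CompleteSpace X]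
    (hX : HyperplaneCond X)
    (F : Type) [NormedAddCommGroup F] [NormedSpace ℝ F] [FiniteDimensional ℝ F]
    (φ : F →ₗ[ℝ] ℝ) (f0 : F) (hf0 : φ f0 = 1) (T : LinearMap.ker φ →ₗ[ℝ] X) (c : ℝ) (hc : 1 ≤ c)
    (hT1 : ∀ e, c⁻¹ * ‖e‖ ≤ ‖T e‖) (hT2 : ∀ e, ‖T e‖ ≤ c * ‖e‖) (c' : ℝ) (hc' : c < c') :
    ∃ S : F →ₗ[ℝ] X, (∀ e : LinearMap.ker φ, S e = T e) ∧
      ∀ f, c'⁻¹ * ‖f‖ ≤ ‖S f‖ ∧ ‖S f‖ ≤ c' * ‖f‖ := by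
  have hc0 : 0 < c := by linarith
  have hc0' : 0 < c' := by linarith
  obtain ⟨Z, _, _, _, i, k, hi, hfr, hki, hk1, hk2⟩ :=
    exists_pushout X F φ f0 hf0 T c hc hT1 hT2
  have hcl : IsClosed ((LinearMap.range i : Subspace ℝ Z) : Set Z) := by
    rw [LinearMap.coe_range]
    exact (AddMonoidHomClass.isometry_of_norm i hi).isClosedEmbedding.isClosed_range
  have hinj : Function.Injective i := (AddMonoidHomClass.isometry_of_norm i hi).injective
  let e := LinearEquiv.ofInjective i hinj
  have he : ∀ x, ((e x : LinearMap.range i) : Z) = i x := fun x => rfl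
  have hsymm : ∀ y, ‖e.symm y‖ = ‖y‖ := by
    intro y
    rw [← hi, ← he, e.apply_symm_apply]; rfl
  have hε : 0 < c' / c - 1 := by
    rw [sub_pos, one_lt_div hc0]; exact hc'
  obtain ⟨U, hU1, hU2⟩ := (hX Z i hi hcl hfr).2 (c' / c - 1) hε (LinearMap.range k) inferInstance
  have hcc : 1 + (c' / c - 1) = c' / c := by ring
  unfold IsEpsIsometry at hU2
  rw [hcc] at hU2
  refine ⟨e.symm.toLinearMap ∘ₗ U ∘ₗ k.rangeRestrict, fun x => ?_, fun f => ?_⟩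
  · simp only [LinearMap.comp_apply, LinearEquiv.coe_coe]
    rw [LinearEquiv.symm_apply_eq]
    apply Subtype.ext
    rw [hU1, he, ← hki]
    · rfl
    · exact ⟨T x, (hki x).symm⟩
  · simp only [LinearMap.comp_apply, LinearEquiv.coe_coe]
    rw [hsymm]
    obtain ⟨h1, h2⟩ := hU2 (k.rangeRestrict f)
    have h3 : ‖k.rangeRestrict f‖ = ‖k f‖ := rfl
    rw [h3] at h1 h2
    constructor
    · refine le_trans ?_ h1
      calc c'⁻¹ * ‖f‖ = (c' / c)⁻¹ * (c⁻¹ * ‖f‖) := by field_simp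
        _ ≤ (c' / c)⁻¹ * ‖k f‖ := by gcongr; exact hk1 f
    · refine h2.trans ?_
      calc (c' / c) * ‖k f‖ ≤ (c' / c) * (c * ‖f‖) := by gcongr; exact hk2 f
        _ = c' * ‖f‖ := by field_simp

/-- Full extension by induction on the dimension. -/
theorem extension_full (X : Type u) [NormedAddCommGroup X] [NormedSpace ℝ X] [CompleteSpace X]
    (hX : HyperplaneCond X) (E : Type) [NormedAddCommGroup E] [NormedSpace ℝ E]
    (T : E →ₗ[ℝ] X) (hT : ∀ e, ‖T e‖ = ‖e‖) (n : ℕ) :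
    ∀ (F : Type) [NormedAddCommGroup F] [NormedSpace ℝ F] [FiniteDimensional ℝ F]
      (j : E →ₗ[ℝ] F) (_ : ∀ e, ‖j e‖ = ‖e‖) (_ : Module.finrank ℝ F = n) (c : ℝ) (_ : 1 < c),
      ∃ S : F →ₗ[ℝ] X, (∀ e, S (j e) = T e) ∧
        ∀ f, c⁻¹ * ‖f‖ ≤ ‖S f‖ ∧ ‖S f‖ ≤ c * ‖f‖ := by
  induction n using Nat.strong_induction_on with
  | _ n ih =>
  intro F _ _ _ j hj hn c hc
  by_cases htop : LinearMap.range j = ⊤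
  · have hinj : Function.Injective j := (AddMonoidHomClass.isometry_of_norm j hj).injective
    let b := LinearEquiv.ofBijective j ⟨hinj, LinearMap.range_eq_top.1 htop⟩
    have hb : ∀ x, b x = j x := fun x => rfl
    refine ⟨T ∘ₗ b.symm.toLinearMap, fun e => ?_, fun f => ?_⟩
    · simp [← hb]
    · have : ‖(T ∘ₗ b.symm.toLinearMap) f‖ = ‖f‖ := by
        rw [LinearMap.comp_apply, hT, ← hj, ← hb, LinearEquiv.coe_coe, b.apply_symm_apply]
      rw [this]
      have := norm_nonneg f
      have := inv_le_one_of_one_le₀ hc.le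
      constructor <;> nlinarith
  · obtain ⟨φ, hφ, hle⟩ := Submodule.exists_le_ker_of_lt_top _ (lt_top_iff_ne_top.2 htop)
    obtain ⟨f1, hf1⟩ : ∃ f, φ f ≠ 0 := by
      by_contra! h
      exact hφ (LinearMap.ext h)
    have hlt : Module.finrank ℝ (LinearMap.ker φ) < n := by
      rw [← hn]
      apply Submodule.finrank_lt
      intro h
      exact hφ (LinearMap.ker_eq_top.1 h)
    obtain ⟨d, hd1, hd2⟩ := exists_between hc
    obtain ⟨S, hS1, hS2⟩ := ih _ hlt (LinearMap.ker φ)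
      (j.codRestrict _ (fun e => hle ⟨e, rfl⟩)) (fun e => hj e) rfl d hd1
    obtain ⟨S', h1, h2⟩ := extension_step X hX F φ ((φ f1)⁻¹ • f1) (by simp [hf1]) S d hd1.le
      (fun e => (hS2 e).1) (fun e => (hS2 e).2) c hd2
    refine ⟨S', fun e => ?_, h2⟩
    rw [← hS1, ← h1]
    rfl

/-- A Banach space `X` is a Gurariy space if and only if it is an a.i.-ideal in every
superspace in which it embeds (isometrically) as a closed hyperplane, i.e. a closed
subspace of codimension one. -/
theorem gurariy_iff_aiIdeal_in_hyperplane_superspaces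
    (X : Type u) [NormedAddCommGroup X] [NormedSpace ℝ X] [CompleteSpace X] :
    IsGurariy X ↔
      ∀ (Z : Type u) [NormedAddCommGroup Z] [NormedSpace ℝ Z] [CompleteSpace Z]
        (i : X →ₗ[ℝ] Z),
        (∀ x : X, ‖i x‖ = ‖x‖) →
        IsClosed ((LinearMap.range i : Subspace ℝ Z) : Set Z) →
        Module.finrank ℝ (Z ⧸ LinearMap.range i) = 1 →
        IsAIIdeal (LinearMap.range i) := by
  constructor
  · intro hX Z _ _ _ i hi hcl _
    exact gurariy_forward hX i hi hcl
  · intro hX ε hε F _ _ _ E T hT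
    obtain ⟨S, h1, h2⟩ := extension_full X hX E T hT _ F E.subtype (fun e => rfl) rfl (1 + ε)
      (by linarith)
    exact ⟨S, h1, h2⟩
end
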